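/- Let T be a tree (a topological graph containing no circle) and let f : T → T be a continuous map. Then cl(R(f)) = cl(P(f)). -/

import Mathlib

open Set Function Filter Topology Metric

noncomputable section

/-- An open arc: a subspace homeomorphic to the open interval `(0,1)`. -/
def IsOpenArc {G : Type*} [TopologicalSpace G] (A : Set G) : Prop :=
  Nonempty (A ≃ₜ Set.Ioo (0 : ℝ) 1)

/-- A circle: a subspace homeomorphic to the unit circle. -/
def IsCircle {G : Type*} [TopologicalSpace G] (C : Set G) : Prop :=
  Nonempty (C ≃ₜ Metric.sphere (0 : ℂ) 1)

/-- A (topological) graph: a non-degenerate compact connected metric space with a finite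
vertex set `V` such that every connected component of the complement of `V` is an open arc,
and every circle contains at least three vertices. -/
structure IsTopGraph {G : Type*} [MetricSpace G] (V : Set G) : Prop where
  nontrivial : Nontrivial G
  compact : CompactSpace G
  connected : ConnectedSpace G
  finite_vertexSet : V.Finite
  component_openArc : ∀ x ∈ Vᶜ, IsOpenArc (connectedComponentIn Vᶜ x)
  circle_vertices : ∀ C : Set G, IsCircle C → 3 ≤ (C ∩ V).ncard

/-- The set of eventually periodic points: points with finite orbit. -/
def evPeriodicPts {G : Type*} (f : G → G) : Set G :=
  {x | (Set.range fun n : ℕ => f^[n] x).Finite}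

/-- `EP_n(f)`: points whose orbit contains at most `n` points. -/
def evPeriodicPtsLe {G : Type*} (f : G → G) (n : ℕ) : Set G :=
  {x | (Set.range fun i : ℕ => f^[i] x).encard ≤ n}

/-- The ω-limit set of a point `x` under `f`. -/
def omegaSet {G : Type*} [TopologicalSpace G] (f : G → G) (x : G) : Set G :=
  ⋂ i : ℕ, closure (Set.range fun n : ℕ => f^[n + i] x)

/-- The ω-limit set of `f`. -/
def omegaLimitSet {G : Type*} [TopologicalSpace G] (f : G → G) : Set G :=
  ⋃ x : G, omegaSet f x

/-- The set of recurrent points of `f`. -/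
def recurrentPts {G : Type*} [TopologicalSpace G] (f : G → G) : Set G :=
  {x | x ∈ omegaSet f x}

/-- The set of non-wandering points of `f`. -/
def nonwanderingPts {G : Type*} [TopologicalSpace G] (f : G → G) : Set G :=
  {x | ∀ U : Set G, IsOpen U → x ∈ U → ∃ n : ℕ, 0 < n ∧ (f^[n] '' U ∩ U).Nonempty}

/-- The set of almost periodic points of `f`. -/
def almostPeriodicPts {G : Type*} [TopologicalSpace G] (f : G → G) : Set G :=
  {x | ∀ U : Set G, IsOpen U → x ∈ U →
    ∃ m : ℕ, 0 < m ∧ ∀ n : ℕ, ∃ i : ℕ, 1 ≤ i ∧ i ≤ m ∧ f^[n + i] x ∈ U}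

/-- The ω-limit set of `x` under the restriction `f|K` (closures taken in the subspace `K`). -/
def omegaSetIn {G : Type*} [TopologicalSpace G] (f : G → G) (K : Set G) (x : G) : Set G :=
  ⋂ i : ℕ, (closure (Set.range fun n : ℕ => f^[n + i] x) ∩ K)

/-- The ω-limit set `ω(f|K)` of the restriction of `f` to `K`. -/
def omegaLimitSetIn {G : Type*} [TopologicalSpace G] (f : G → G) (K : Set G) : Set G :=
  ⋃ x ∈ K, omegaSetIn f K x

/-- The non-wandering set `Ω(f|K)` of the restriction of `f` to `K`. -/
def nonwanderingPtsIn {G : Type*} [TopologicalSpace G] (f : G → G) (K : Set G) : Set G :=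
  {x | x ∈ K ∧ ∀ U : Set G, IsOpen U → x ∈ U →
    ∃ n : ℕ, 0 < n ∧ (f^[n] '' (U ∩ K) ∩ (U ∩ K)).Nonempty}

/-- The almost periodic set `AP(f|K)` of the restriction of `f` to `K`. -/
def almostPeriodicPtsIn {G : Type*} [TopologicalSpace G] (f : G → G) (K : Set G) : Set G :=
  {x | x ∈ K ∧ ∀ U : Set G, IsOpen U → x ∈ U →
    ∃ m : ℕ, 0 < m ∧ ∀ n : ℕ, ∃ i : ℕ, 1 ≤ i ∧ i ≤ m ∧ f^[n + i] x ∈ U}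

/-- The orbit `O(K,f)` of a set `K` under `f`. -/
def setOrbit {G : Type*} (f : G → G) (K : Set G) : Set G := ⋃ i : ℕ, f^[i] '' K

/-- The orbit segment `O_n(K,f)`. -/
def setOrbitSeg {G : Type*} (f : G → G) (K : Set G) (n : ℕ) : Set G :=
  ⋃ i ≤ n, f^[i] '' K

/-- The inverse orbit (absorbed set) `O₋(K,f)`. -/
def invOrbit {G : Type*} (f : G → G) (K : Set G) : Set G := ⋃ i : ℕ, f^[i] ⁻¹' K

/-- The main absorbed set `Ab(K,f)`: the union of the connected components of `O₋(K,f)`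
that meet `K`. -/
def mainAbsorbed {G : Type*} [TopologicalSpace G] (f : G → G) (K : Set G) : Set G :=
  ⋃ x ∈ K, connectedComponentIn (invOrbit f K) x

/-- A minimal set of `f`: nonempty, closed, invariant, with no proper such subset. -/
def IsMinimalSet {G : Type*} [TopologicalSpace G] (f : G → G) (M : Set G) : Prop :=
  M.Nonempty ∧ IsClosed M ∧ f '' M ⊆ M ∧
    ∀ N : Set G, N ⊆ M → N.Nonempty → IsClosed N → f '' N ⊆ N → N = M

open Classical in
/-- The valence of a point `x` in a metric space: the limit, as `r → 0⁺`, of the number of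
boundary points of the ball `B(x,r)` (defined as the eventual value, if it exists). -/
def valence {G : Type*} [MetricSpace G] (x : G) : ℕ :=
  if h : ∃ n : ℕ, ∀ᶠ r in nhdsWithin (0 : ℝ) (Set.Ioi 0),
      (frontier (Metric.ball x r)).ncard = n
  then h.choose else 0

/-- The set of branching points. -/
def branchPts (G : Type*) [MetricSpace G] : Set G := {x | 2 < valence x}

/-- The total branching number `ξ(U)` of a subset `U` of `G`. -/
def totalBranch {G : Type*} [MetricSpace G] (U : Set G) : ℕ :=
  ∑ᶠ v ∈ U ∩ branchPts G, (valence v - 2)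

/-- Cyclic successor on `Fin k`. -/
def finSucc {k : ℕ} (i : Fin k) : Fin k := ⟨(i.1 + 1) % k, Nat.mod_lt _ i.pos⟩

/-- `C : Fin k → Set G` enumerates the connected components of `X`, and `f` maps each
component into the (cyclically) next one. -/
def IsCyclicDecomp {G : Type*} [TopologicalSpace G] (f : G → G) (X : Set G)
    {k : ℕ} (C : Fin k → Set G) : Prop :=
  (⋃ i, C i) = X ∧ (∀ i, (C i).Nonempty) ∧
  (∀ i, ∀ x ∈ C i, connectedComponentIn X x = C i) ∧
  Function.Injective C ∧ ∀ i, f '' C i ⊆ C (finSucc i)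

/-- A component-cyclic `f`-invariant set. -/
def ComponentCyclic {G : Type*} [TopologicalSpace G] (f : G → G) (X : Set G) : Prop :=
  ∃ (k : ℕ) (C : Fin k → Set G), 0 < k ∧ IsCyclicDecomp f X C

/-- `A` is a connected component of `S`. -/
def IsCompOf {G : Type*} [TopologicalSpace G] (A S : Set G) : Prop :=
  ∃ x ∈ S, connectedComponentIn S x = A

/-- The distance between two sets. -/
def setDist {G : Type*} [MetricSpace G] (A B : Set G) : ℝ :=
  sInf {r : ℝ | ∃ a ∈ A, ∃ b ∈ B, dist a b = r}

end

/-! ### Recurrence along an arc -/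

/-- If `t` returns to `I` to its right under `φ ∘ F ∘ s`, and no iterate of `F` has a
fixed point on `s '' I`, then every iterate of `F` moves every point of `s '' I` to the right. -/
theorem iterate_displacement_pos {T : Type*} {F : T → T} {φ : T → ℝ} {s : ℝ → T} {I : Set ℝ}
    (hs : ∀ y, φ y ∈ I → s (φ y) = y)
    (hsign : ∀ n, 0 < n → (∀ t ∈ I, t < φ (F^[n] (s t))) ∨ (∀ t ∈ I, φ (F^[n] (s t)) < t))
    {t : ℝ} (ht : t ∈ I) (hFt : φ (F (s t)) ∈ I) (hlt : t < φ (F (s t))) (k : ℕ) :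
    ∀ u ∈ I, u < φ (F^[k + 1] (s u)) := by
  induction k with
  | zero =>
    refine (hsign 1 one_pos).resolve_right fun h => ?_
    exact lt_asymm hlt (h t ht)
  | succ k ih =>
    refine (hsign (k + 2) (by omega)).resolve_right fun h => ?_
    have h1 := ih _ hFt
    rw [hs _ hFt, ← Function.iterate_succ_apply] at h1
    exact lt_asymm (hlt.trans h1) (h t ht)

theorem iterate_displacement_neg {T : Type*} {F : T → T} {φ : T → ℝ} {s : ℝ → T} {I : Set ℝ}
    (hs : ∀ y, φ y ∈ I → s (φ y) = y)
    (hsign : ∀ n, 0 < n → (∀ t ∈ I, t < φ (F^[n] (s t))) ∨ (∀ t ∈ I, φ (F^[n] (s t)) < t))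
    {t : ℝ} (ht : t ∈ I) (hFt : φ (F (s t)) ∈ I) (hlt : φ (F (s t)) < t) (k : ℕ) :
    ∀ u ∈ I, φ (F^[k + 1] (s u)) < u := by
  have key := iterate_displacement_pos (F := F) (φ := fun y => -φ y) (s := fun r => s (-r))
    (I := -I) (t := -t) (fun y hy => by simpa using hs y (by simpa using hy))
    (fun n hn => (hsign n hn).symm.imp (fun h r hr => by linarith [h (-r) hr])
      (fun h r hr => by linarith [h (-r) hr])) (by simpa using ht) (by simpa using hFt)
    (by simpa using hlt) k
  intro u hu
  simpa using key (-u) (by simpa using hu)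

/-- Where no periodic point lies over an open interval `I`, points of `I` cannot return to `I` both
from the left and from the right. -/
theorem not_return_both_sides {T : Type*} [TopologicalSpace T] {f : T → T} (hf : Continuous f)
    {φ : T → ℝ} (hφ : Continuous φ) {s : ℝ → T} {I : Set ℝ} (hI : IsPreconnected I)
    (hsc : ContinuousOn s I) (hs : ∀ y, φ y ∈ I → s (φ y) = y)
    (hper : ∀ t ∈ I, s t ∉ Function.periodicPts f)
    {n m : ℕ} (hn : 0 < n) (hm : 0 < m) {t u : ℝ} (ht : t ∈ I) (hu : u ∈ I)
    (hft : φ (f^[n] (s t)) ∈ I) (hfu : φ (f^[m] (s u)) ∈ I)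
    (hlt : t < φ (f^[n] (s t))) (hgt : φ (f^[m] (s u)) < u) : False := by
  have hsign : ∀ k, 0 < k →
      (∀ r ∈ I, r < φ (f^[k] (s r))) ∨ (∀ r ∈ I, φ (f^[k] (s r)) < r) := by
    intro k hk
    have hcont : ContinuousOn (fun r => φ (f^[k] (s r))) I :=
      (hφ.comp (hf.iterate k)).comp_continuousOn hsc
    by_contra! hcon
    obtain ⟨⟨a, ha, hale⟩, b, hb, hble⟩ := hcon
    obtain ⟨c, hc, hceq⟩ := hI.intermediate_value₂ ha hb hcont continuousOn_id hale hble
    have hceq : φ (f^[k] (s c)) = c := hceq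
    have h2 := hs (f^[k] (s c)) (hceq.symm ▸ hc)
    rw [hceq] at h2
    exact hper c hc ⟨k, hk, h2.symm⟩
  have hsign' : ∀ l, 0 < l → ∀ k, 0 < k →
      (∀ r ∈ I, r < φ ((f^[l])^[k] (s r))) ∨ (∀ r ∈ I, φ ((f^[l])^[k] (s r)) < r) := by
    intro l hl k hk
    simp only [← Function.iterate_mul]
    exact hsign _ (Nat.mul_pos hl hk)
  have h1 := iterate_displacement_pos hs (hsign' n hn) ht hft hlt (m - 1) t ht
  have h2 := iterate_displacement_neg hs (hsign' m hm) hu hfu hgt (n - 1) t ht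
  rw [Nat.sub_add_cancel hm, ← Function.iterate_mul] at h1
  rw [Nat.sub_add_cancel hn, ← Function.iterate_mul, mul_comm] at h2
  exact lt_asymm h1 h2

theorem exists_iterate_mem_of_mem_recurrentPts {T : Type*} [TopologicalSpace T] {f : T → T} {x : T}
    (hx : x ∈ recurrentPts f) {U : Set T} (hU : U ∈ 𝓝 x) (i : ℕ) : ∃ n, i ≤ n ∧ f^[n] x ∈ U := by
  obtain ⟨_, h, n, rfl⟩ := mem_closure_iff_nhds.1 (mem_iInter.1 hx i) U hU
  exact ⟨n + i, by omega, h⟩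

theorem mem_closure_periodicPts_of_free_arc {T : Type*} [TopologicalSpace T] {f : T → T}
    (hf : Continuous f) {φ : T → ℝ} (hφ : Continuous φ) {s : ℝ → T} (hsc : Continuous s)
    (hs : ∀ y, φ y ∈ Ioo (0 : ℝ) 1 → s (φ y) = y) {x : T} (hx : x ∈ recurrentPts f)
    (hφx : φ x ∈ Ioo (0 : ℝ) 1) : x ∈ closure (Function.periodicPts f) := by
  by_contra hcl
  have hU : s ⁻¹' (closure (Function.periodicPts f))ᶜ ∩ Ioo 0 1 ∈ 𝓝 (φ x) := by
    refine inter_mem (hsc.continuousAt.preimage_mem_nhds ?_) (isOpen_Ioo.mem_nhds hφx)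
    rw [hs x hφx]
    exact isClosed_closure.isOpen_compl.mem_nhds hcl
  obtain ⟨a, b, hab, hsub⟩ := mem_nhds_iff_exists_Ioo_subset.1 hU
  have hs' : ∀ y, φ y ∈ Ioo a b → s (φ y) = y := fun y hy => hs y (hsub hy).2
  have hper : ∀ t ∈ Ioo a b, s t ∉ Function.periodicPts f :=
    fun t ht hp => (hsub ht).1 (subset_closure hp)
  have nhds_of : ∀ {c d}, φ x ∈ Ioo c d → φ ⁻¹' Ioo c d ∈ 𝓝 x := fun h =>
    hφ.continuousAt.preimage_mem_nhds (isOpen_Ioo.mem_nhds h)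
  obtain ⟨n, hn, hnI⟩ := exists_iterate_mem_of_mem_recurrentPts hx (nhds_of hab) 1
  have hsx : s (φ x) = x := hs' x hab
  have hsn : s (φ (f^[n] x)) = f^[n] x := hs' _ hnI
  have shift : ∀ {m}, n + 1 ≤ m → f^[m - n] (f^[n] x) = f^[m] x := fun h => by
    rw [← Function.iterate_add_apply, Nat.sub_add_cancel (by omega)]
  rcases lt_trichotomy (φ x) (φ (f^[n] x)) with hlt | heq | hgt
  · obtain ⟨m, hm, hmI⟩ := exists_iterate_mem_of_mem_recurrentPts hx (nhds_of ⟨hab.1, hlt⟩) (n + 1)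
    exact not_return_both_sides hf hφ isPreconnected_Ioo hsc.continuousOn hs' hper
      (n := n) (m := m - n) hn (by omega) hab hnI (by rwa [hsx])
      (by rw [hsn, shift hm]; exact ⟨hmI.1, hmI.2.trans hnI.2⟩) (by rwa [hsx])
      (by rw [hsn, shift hm]; exact hmI.2)
  · refine hper _ hab ⟨n, hn, ?_⟩
    rw [hsx, Function.IsPeriodicPt, Function.IsFixedPt, ← hsn, ← heq, hsx]
  · obtain ⟨m, hm, hmI⟩ := exists_iterate_mem_of_mem_recurrentPts hx (nhds_of ⟨hgt, hab.2⟩) (n + 1)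
    exact not_return_both_sides hf hφ isPreconnected_Ioo hsc.continuousOn hs' hper
      (n := m - n) (m := n) (by omega) hn hnI hab
      (by rw [hsn, shift hm]; exact ⟨hnI.1.trans hmI.1, hmI.2⟩) (by rwa [hsx])
      (by rw [hsn, shift hm]; exact hmI.1) (by rwa [hsx])

theorem periodicPts_subset_recurrentPts {T : Type*} [TopologicalSpace T] (f : T → T) :
    Function.periodicPts f ⊆ recurrentPts f := by
  rintro x ⟨n, hn, hx⟩
  refine mem_iInter.2 fun i => subset_closure ⟨n * i - i + 0, ?_⟩
  have : n * i - i + 0 + i = n * i := by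
    have := Nat.le_mul_of_pos_left i hn
    omega
  simp only [this]
  exact hx.mul_const i

theorem iterate_mem_recurrentPts {T : Type*} [TopologicalSpace T] {f : T → T} (hf : Continuous f)
    {x : T} (hx : x ∈ recurrentPts f) (k : ℕ) : f^[k] x ∈ recurrentPts f := by
  refine mem_iInter.2 fun i => mem_closure_iff_nhds.2 fun U hU => ?_
  obtain ⟨n, hn, h⟩ := exists_iterate_mem_of_mem_recurrentPts hx
    ((hf.iterate k).continuousAt.preimage_mem_nhds hU) i
  refine ⟨_, h, n - i, ?_⟩
  simp only [Nat.sub_add_cancel hn, ← Function.iterate_add_apply, add_comm]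

/-- It suffices to approximate recurrent points outside a finite set by periodic points. -/
theorem recurrentPts_subset_closure_periodicPts {T : Type*} [TopologicalSpace T] [T1Space T]
    {f : T → T} (hf : Continuous f) {V : Set T} (hV : V.Finite)
    (h : ∀ x ∈ recurrentPts f, x ∉ V → x ∈ closure (Function.periodicPts f)) :
    recurrentPts f ⊆ closure (Function.periodicPts f) := by
  intro x hx
  by_cases hinj : Function.Injective fun n => f^[n] x
  · have hfin : {n | f^[n] x ∈ V}.Finite := hV.preimage hinj.injOn
    obtain ⟨N, hN⟩ := hfin.bddAbove
    rw [← isClosed_closure.closure_eq]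
    refine mem_closure_iff_nhds.2 fun U hU => ?_
    obtain ⟨n, hn, hnU⟩ := exists_iterate_mem_of_mem_recurrentPts hx hU (N + 1)
    refine ⟨_, hnU, h _ (iterate_mem_recurrentPts hf hx n) fun hmem => ?_⟩
    have : n ≤ N := hN hmem
    omega
  · obtain ⟨i, j, hij, hlt⟩ : ∃ i j, f^[i] x = f^[j] x ∧ i < j := by
      simp only [Function.Injective, not_forall] at hinj
      obtain ⟨i, j, hij, hne⟩ := hinj
      rcases lt_or_gt_of_ne hne with h | h
      exacts [⟨i, j, hij, h⟩, ⟨j, i, hij.symm, h⟩]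
    have hp : f^[i] x ∈ Function.periodicPts f := by
      refine ⟨j - i, by omega, ?_⟩
      rw [Function.IsPeriodicPt, Function.IsFixedPt, ← Function.iterate_add_apply,
        Nat.sub_add_cancel hlt.le, hij]
    have hfinite : (Set.range fun k => f^[k] (f^[i] x)).Finite := by
      obtain ⟨p, hp0, hpp⟩ := hp
      refine ((Set.finite_lt_nat p).image fun k => f^[k] (f^[i] x)).subset ?_
      rintro _ ⟨k, rfl⟩
      exact ⟨k % p, Nat.mod_lt _ hp0, hpp.iterate_mod_apply k⟩
    obtain ⟨k, hk⟩ : x ∈ Set.range fun k => f^[k] (f^[i] x) := by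
      rw [← hfinite.isClosed.closure_eq]
      have := mem_iInter.1 hx i
      simpa only [Function.iterate_add_apply] using this
    refine subset_closure ?_
    obtain ⟨p, hp0, hpp⟩ := hp
    refine ⟨p, hp0, ?_⟩
    rw [← hk]
    exact hpp.apply_iterate k

/-! ### Arcs and circles -/

/-- `K` is an arc with endpoints `a` and `b`. -/
def IsArcBetween {G : Type*} [TopologicalSpace G] (K : Set G) (a b : G) : Prop :=
  ∃ γ : Path a b, Function.Injective γ ∧ Set.range γ = K

namespace IsArcBetween

variable {G : Type*} [TopologicalSpace G] {K L : Set G} {a b c : G}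

theorem symm (h : IsArcBetween K a b) : IsArcBetween K b a := by
  obtain ⟨γ, hγ, rfl⟩ := h
  exact ⟨γ.symm, hγ.comp unitInterval.symm_bijective.injective, γ.symm_range⟩

theorem left_mem (h : IsArcBetween K a b) : a ∈ K := by
  obtain ⟨γ, -, rfl⟩ := h
  exact ⟨0, γ.source⟩

theorem right_mem (h : IsArcBetween K a b) : b ∈ K := h.symm.left_mem

theorem isClosed [T2Space G] (h : IsArcBetween K a b) : IsClosed K := by
  obtain ⟨γ, -, rfl⟩ := h
  exact (isCompact_range γ.continuous).isClosed

end IsArcBetween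

/-- If two injective paths meet only at their junction and possibly at their outer endpoints, their
concatenation is injective except possibly for the outer endpoints. -/
theorem Path.eq_or_endpoints_of_trans_eq {G : Type*} [TopologicalSpace G] {a b c : G}
    {γ : Path a b} {δ : Path b c} (hγ : Function.Injective γ) (hδ : Function.Injective δ)
    (h : ∀ s t, γ s = δ t → (s = 1 ∧ t = 0) ∨ (s = 0 ∧ t = 1)) {s t : unitInterval}
    (hst : γ.trans δ s = γ.trans δ t) :
    s = t ∨ (s = 0 ∧ t = 1) ∨ (s = 1 ∧ t = 0) := by
  rw [Path.trans_apply, Path.trans_apply] at hst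
  split_ifs at hst with h1 h2 h2
  · left
    have := congrArg Subtype.val (hγ hst)
    ext
    simpa using this
  · rcases h _ _ hst with ⟨h3, h4⟩ | ⟨h3, h4⟩
    · have := congrArg Subtype.val h4
      simp only [Set.Icc.coe_zero] at this
      exact absurd (by linarith) h2
    · have h3 := congrArg Subtype.val h3
      have h4 := congrArg Subtype.val h4
      simp only [Set.Icc.coe_zero, Set.Icc.coe_one] at h3 h4
      exact Or.inr (Or.inl ⟨Subtype.ext (by rw [Set.Icc.coe_zero]; linarith),
        Subtype.ext (by rw [Set.Icc.coe_one]; linarith)⟩)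
  · rcases h _ _ hst.symm with ⟨h3, h4⟩ | ⟨h3, h4⟩
    · have := congrArg Subtype.val h4
      simp only [Set.Icc.coe_zero] at this
      exact absurd (by linarith) h1
    · have h3 := congrArg Subtype.val h3
      have h4 := congrArg Subtype.val h4
      simp only [Set.Icc.coe_zero, Set.Icc.coe_one] at h3 h4
      exact Or.inr (Or.inr ⟨Subtype.ext (by rw [Set.Icc.coe_one]; linarith),
        Subtype.ext (by rw [Set.Icc.coe_zero]; linarith)⟩)
  · left
    have := congrArg Subtype.val (hδ hst)
    ext
    simp only at this
    linarith

theorem IsArcBetween.trans {G : Type*} [TopologicalSpace G] {K L : Set G} {a b c : G}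
    (hK : IsArcBetween K a b) (hL : IsArcBetween L b c) (h : K ∩ L ⊆ {b}) (hac : a ≠ c) :
    IsArcBetween (K ∪ L) a c := by
  obtain ⟨γ, hγ, rfl⟩ := hK
  obtain ⟨δ, hδ, rfl⟩ := hL
  refine ⟨γ.trans δ, fun s t hst => ?_, γ.trans_range δ⟩
  have key : ∀ s t, γ s = δ t → (s = 1 ∧ t = 0) ∨ (s = 0 ∧ t = 1) := fun s t e => by
    have hb : γ s = b := h ⟨⟨s, rfl⟩, ⟨t, e.symm⟩⟩
    exact Or.inl ⟨hγ (hb.trans γ.target.symm), hδ ((e.symm.trans hb).trans δ.source.symm)⟩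
  rcases Path.eq_or_endpoints_of_trans_eq hγ hδ key hst with h | ⟨rfl, rfl⟩ | ⟨rfl, rfl⟩
  · exact h
  · exact absurd (by simpa using hst) hac
  · exact absurd (by simpa using hst.symm) hac

/-- The range of a simple closed curve is a circle. -/
theorem isCircle_range_of_simple_loop {G : Type*} [TopologicalSpace G] [T2Space G] {a : G}
    (p : Path a a) (hp : ∀ s t, p s = p t → s = t ∨ (s = 0 ∧ t = 1) ∨ (s = 1 ∧ t = 0)) :
    IsCircle (Set.range p) := by
  have hc : Continuous (AddCircle.liftIco 1 0 p.extend) :=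
    AddCircle.liftIco_zero_continuous (by simp) p.continuous_extend.continuousOn
  have val : ∀ t : unitInterval, (t : ℝ) < 1 →
      AddCircle.liftIco 1 0 p.extend ((t : ℝ) : AddCircle (1 : ℝ)) = p t := fun t ht => by
    rw [AddCircle.liftIco_zero_coe_apply ⟨t.2.1, ht⟩, Path.extend_apply _ t.2]
  have rep : ∀ z : AddCircle (1 : ℝ),
      ∃ t : unitInterval, (t : ℝ) < 1 ∧ ((t : ℝ) : AddCircle (1 : ℝ)) = z := by
    intro z
    obtain ⟨t, ht, rfl⟩ := AddCircle.eq_coe_Ico z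
    exact ⟨⟨t, ht.1, ht.2.le⟩, ht.2, rfl⟩
  have hinj : Function.Injective (AddCircle.liftIco 1 0 p.extend) := by
    intro z w hzw
    obtain ⟨s, hs, rfl⟩ := rep z
    obtain ⟨t, ht, rfl⟩ := rep w
    rw [val s hs, val t ht] at hzw
    rcases hp s t hzw with rfl | ⟨-, rfl⟩ | ⟨rfl, -⟩
    · rfl
    · simp at ht
    · simp at hs
  have hrange : Set.range (AddCircle.liftIco 1 0 p.extend) = Set.range p := by
    refine Subset.antisymm ?_ ?_
    · rintro _ ⟨z, rfl⟩
      obtain ⟨s, hs, rfl⟩ := rep z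
      exact ⟨s, (val s hs).symm⟩
    · rintro _ ⟨t, rfl⟩
      rcases t.2.2.lt_or_eq with ht | ht
      · exact ⟨_, val t ht⟩
      · refine ⟨((0 : unitInterval) : ℝ), ?_⟩
        rw [val 0 (by simp), show t = 1 from Subtype.ext ht, p.source, p.target]
  rw [← hrange]
  have hemb := (hc.isClosedEmbedding hinj).isEmbedding
  exact ⟨hemb.toHomeomorph.symm.trans (AddCircle.homeomorphCircle one_ne_zero)⟩

/-- Two arcs that meet exactly at their endpoints form a circle. -/
theorem IsArcBetween.isCircle_union {G : Type*} [TopologicalSpace G] [T2Space G] {K L : Set G}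
    {a b : G} (hK : IsArcBetween K a b) (hL : IsArcBetween L a b) (h : K ∩ L ⊆ {a, b}) :
    IsCircle (K ∪ L) := by
  obtain ⟨γ, hγ, rfl⟩ := hK
  obtain ⟨δ, hδ, rfl⟩ := hL.symm
  rw [← γ.trans_range δ]
  refine isCircle_range_of_simple_loop _ fun s t hst => ?_
  refine Path.eq_or_endpoints_of_trans_eq hγ hδ (fun s t e => ?_) hst
  rcases h ⟨⟨s, rfl⟩, ⟨t, e.symm⟩⟩ with ha | hb
  · exact Or.inr ⟨hγ (ha.trans γ.source.symm), hδ ((e.symm.trans ha).trans δ.target.symm)⟩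
  · exact Or.inl ⟨hγ (Eq.trans hb γ.target.symm), hδ ((e.symm.trans hb).trans δ.source.symm)⟩

/-- An arc joining two disjoint closed sets which together cover the rest of the space can be
parametrized by a continuous function on the whole space. -/
theorem exists_continuous_parameter_of_separated {G : Type*} [TopologicalSpace G] [T2Space G]
    {A B : Set G} (hA : IsClosed A) (hB : IsClosed B) (hAB : Disjoint A B) {a b : G}
    {γ : Path a b} (hγ : Function.Injective γ) (hγA : ∀ t, γ t ∈ A ↔ t = 0)
    (hγB : ∀ t, γ t ∈ B ↔ t = 1) (hcover : A ∪ B ∪ Set.range γ = univ) :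
    ∃ φ : G → ℝ, Continuous φ ∧ (∀ y, φ y ∈ Ioo (0 : ℝ) 1 → γ.extend (φ y) = y) ∧
      ∀ y, y ∉ A → y ∉ B → φ y ∈ Ioo (0 : ℝ) 1 := by
  classical
  set φ : G → ℝ := fun y => if y ∈ A then 0 else if y ∈ B then 1 else
    (Function.invFun γ y : unitInterval) with hφ
  have φA : ∀ y ∈ A, φ y = 0 := fun y hy => by simp [hφ, hy]
  have φB : ∀ y ∈ B, φ y = 1 := fun y hy => by simp [hφ, hy, disjoint_right.1 hAB hy]
  have φγ : ∀ t, φ (γ t) = t := fun t => by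
    simp only [hφ, hγA, hγB, Function.leftInverse_invFun hγ t]
    split_ifs with h1 h2 <;> simp [*]
  have cases : ∀ y, y ∈ A ∨ y ∈ B ∨ ∃ t, γ t = y := fun y => by
    have : y ∈ A ∪ B ∪ Set.range γ := hcover ▸ mem_univ y
    rcases this with (h | h) | h
    exacts [Or.inl h, Or.inr (Or.inl h), Or.inr (Or.inr h)]
  refine ⟨φ, ?_, fun y hy => ?_, fun y hyA hyB => ?_⟩
  · have cA : ContinuousOn φ A := continuousOn_const.congr φA
    have cB : ContinuousOn φ B := continuousOn_const.congr φB
    have cγ : ContinuousOn φ (Set.range γ) := by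
      refine continuousOn_iff_isClosed.2 fun F hF => ⟨γ '' (Subtype.val ⁻¹' F), ?_, ?_⟩
      · exact ((hF.preimage continuous_subtype_val).isCompact.image γ.continuous).isClosed
      · ext y
        constructor
        · rintro ⟨hy, t, rfl⟩
          exact ⟨⟨t, by simpa [φγ] using hy, rfl⟩, t, rfl⟩
        · rintro ⟨⟨t, ht, rfl⟩, -⟩
          exact ⟨by simpa [φγ] using ht, t, rfl⟩
    rw [← continuousOn_univ, ← hcover]
    exact (cA.union_of_isClosed cB hA hB).union_of_isClosed cγ (hA.union hB)
      (isCompact_range γ.continuous).isClosed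
  · rcases cases y with h | h | ⟨t, rfl⟩
    · simp [φA y h] at hy
    · simp [φB y h] at hy
    · rw [φγ, Path.extend_apply _ t.2]
  · rcases cases y with h | h | ⟨t, rfl⟩
    · exact absurd h hyA
    · exact absurd h hyB
    · rw [φγ]
      rw [hγA] at hyA
      rw [hγB] at hyB
      exact ⟨unitInterval.pos_iff_ne_zero.2 hyA, unitInterval.lt_one_iff_ne_one.2 hyB⟩

/-! ### Edges of a topological graph -/

/-- An open arc whose ends can only accumulate at a finite set converges at its end. -/
theorem exists_tendsto_end_of_arc {G : Type*} [MetricSpace G] [CompactSpace G] {C V : Set G}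
    (hV : V.Finite) (hCV : closure C ⊆ C ∪ V) {s : ℝ → G} {ψ : G → ℝ}
    (hs : ContinuousOn s (Ioo 0 1)) (hψ : ContinuousOn ψ C)
    (hsC : ∀ t ∈ Ioo (0 : ℝ) 1, s t ∈ C ∧ ψ (s t) = t) (hψC : ∀ y ∈ C, 0 < ψ y) :
    ∃ v ∈ V, Tendsto s (𝓝[>] 0) (𝓝 v) := by
  have hIoo : ∀ {δ : ℝ}, 0 < δ → Ioo 0 δ ∈ 𝓝[>] (0 : ℝ) := fun h => Ioo_mem_nhdsGT h
  have cluster : ∀ w, MapClusterPt w (𝓝[>] 0) s → w ∈ V := by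
    intro w hw
    have hfreq := fun U (hU : U ∈ 𝓝 w) => mapClusterPt_iff_frequently.1 hw U hU
    have hwcl : w ∈ closure C := by
      refine mem_closure_iff_nhds.2 fun U hU => ?_
      obtain ⟨t, htU, ht⟩ := ((hfreq U hU).and_eventually (hIoo one_pos)).exists
      exact ⟨s t, htU, (hsC t ht).1⟩
    refine (hCV hwcl).resolve_left fun hwC => ?_
    have hpos := hψC w hwC
    have hnear : ∀ᶠ y in 𝓝[C] w, ψ w / 2 < ψ y :=
      (hψ w hwC).eventually (lt_mem_nhds (by linarith))
    obtain ⟨t, htU, ht, ht'⟩ := ((hfreq _ (mem_nhdsWithin_iff_eventually.1 hnear)).and_eventually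
      (inter_mem (hIoo one_pos) (hIoo (half_pos hpos)))).exists
    have h1 := htU (hsC t ht).1
    simp only [mem_ofPred_eq, (hsC t ht).2] at h1
    exact lt_asymm h1 ht'.2
  obtain ⟨v, hv⟩ : ∃ v, MapClusterPt v (𝓝[>] 0) s := exists_clusterPt_of_compactSpace _
  have hvV := cluster v hv
  refine ⟨v, hvV, ?_⟩
  obtain ⟨ρ, hρ, hρV⟩ : ∃ ρ > 0, ∀ w ∈ V, dist w v < ρ → w = v := by
    have : (V \ {v})ᶜ ∈ 𝓝 v := (hV.subset sdiff_subset).isClosed.isOpen_compl.mem_nhds (by simp)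
    obtain ⟨ρ, hρ, hsub⟩ := Metric.mem_nhds_iff.1 this
    exact ⟨ρ, hρ, fun w hw hd => by_contra fun hne => hsub hd ⟨hw, hne⟩⟩
  rw [Metric.tendsto_nhds]
  intro ε hε
  by_contra hnot
  rw [Filter.not_eventually] at hnot
  set r := min ε (ρ / 2) with hr
  have hr0 : 0 < r := lt_min hε (half_pos hρ)
  have hsphere : ∃ᶠ t in 𝓝[>] 0, s t ∈ Metric.sphere v r := by
    rw [(nhdsGT_basis (0 : ℝ)).frequently_iff]
    intro δ hδ
    have hδ' : 0 < min δ 1 := lt_min hδ one_pos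
    obtain ⟨t1, h1, ht1⟩ := (hnot.and_eventually (hIoo hδ')).exists
    obtain ⟨t2, h2, ht2⟩ := ((mapClusterPt_iff_frequently.1 hv _
      (Metric.ball_mem_nhds v hr0)).and_eventually (hIoo hδ')).exists
    have hsub : Ioo 0 (min δ 1) ⊆ Ioo (0 : ℝ) 1 := Ioo_subset_Ioo_right (min_le_right _ _)
    obtain ⟨t, ht, hteq⟩ := isPreconnected_Ioo.intermediate_value ht2 ht1
      ((continuous_id.dist continuous_const).comp_continuousOn (hs.mono hsub))
      ⟨(Metric.mem_ball.1 h2).le, (min_le_left _ _).trans (not_lt.1 h1)⟩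
    exact ⟨t, ⟨ht.1, ht.2.trans_le (min_le_left _ _)⟩, hteq⟩
  obtain ⟨w, hwS, hw⟩ := (isCompact_sphere v r).exists_mapClusterPt_of_frequently hsphere
  have hwr : dist w v = r := hwS
  have := hρV w (cluster w hw) (by rw [hwr, hr]; linarith [min_le_right ε (ρ / 2)])
  rw [this, dist_self] at hwr
  exact hr0.ne hwr

theorem IsCompOf.subset {G : Type*} [TopologicalSpace G] {E S : Set G} (h : IsCompOf E S) :
    E ⊆ S := by
  obtain ⟨x, -, rfl⟩ := h
  exact connectedComponentIn_subset S x

theorem IsCompOf.connectedComponentIn_eq {G : Type*} [TopologicalSpace G] {E S : Set G}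
    (h : IsCompOf E S) {y : G} (hy : y ∈ E) : connectedComponentIn S y = E := by
  obtain ⟨x, -, rfl⟩ := h
  exact (_root_.connectedComponentIn_eq hy).symm

theorem IsCompOf.eq_of_mem {G : Type*} [TopologicalSpace G] {E E' S : Set G} (h : IsCompOf E S)
    (h' : IsCompOf E' S) {y : G} (hy : y ∈ E) (hy' : y ∈ E') : E = E' :=
  (h.connectedComponentIn_eq hy).symm.trans (h'.connectedComponentIn_eq hy')

theorem IsCompOf.closure_subset {G : Type*} [TopologicalSpace G] {E V : Set G}
    (h : IsCompOf E Vᶜ) : closure E ⊆ E ∪ V := by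
  obtain ⟨x, hx, rfl⟩ := h
  intro y hy
  by_contra hcon
  rw [mem_union, not_or] at hcon
  have hconn : IsPreconnected (insert y (connectedComponentIn Vᶜ x)) :=
    isPreconnected_connectedComponentIn.subset_closure (subset_insert _ _)
      (insert_subset hy subset_closure)
  exact hcon.1 (hconn.subset_connectedComponentIn
    (mem_insert_of_mem _ (mem_connectedComponentIn hx))
    (insert_subset hcon.2 (connectedComponentIn_subset _ _)) (mem_insert _ _))

/-- `E` is a connected component of the complement of the vertex set `V` whose closure is an arc
between the distinct vertices `a` and `b`. -/
structure IsEdge {G : Type*} [TopologicalSpace G] (V E : Set G) (a b : G) : Prop where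
  isCompOf : IsCompOf E Vᶜ
  left_mem : a ∈ V
  right_mem : b ∈ V
  ne : a ≠ b
  left_mem_closure : a ∈ closure E
  right_mem_closure : b ∈ closure E
  isArcBetween : IsArcBetween (E ∪ {a, b}) a b

theorem IsEdge.symm {G : Type*} [TopologicalSpace G] {V E : Set G} {a b : G}
    (h : IsEdge V E a b) : IsEdge V E b a :=
  ⟨h.isCompOf, h.right_mem, h.left_mem, h.ne.symm, h.right_mem_closure, h.left_mem_closure,
    by simpa only [pair_comm b a] using h.isArcBetween.symm⟩

theorem exists_path_of_isOpenArc {G : Type*} [MetricSpace G] [CompactSpace G] {V C : Set G}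
    (hV : V.Finite) (hC : IsOpenArc C) (hCV : closure C ⊆ C ∪ V) :
    ∃ a ∈ V, ∃ b ∈ V, ∃ γ : Path a b, InjOn γ (Ioo 0 1) ∧ γ '' Ioo 0 1 = C := by
  classical
  obtain ⟨e⟩ := hC
  set p : Ioo (0 : ℝ) 1 := ⟨1 / 2, by norm_num, by norm_num⟩
  set s : ℝ → G := fun t => if h : t ∈ Ioo (0 : ℝ) 1 then e.symm ⟨t, h⟩ else e.symm p with hs
  set ψ : G → ℝ := fun y => if h : y ∈ C then e ⟨y, h⟩ else 0 with hψ
  have s_eq : ∀ t (h : t ∈ Ioo (0 : ℝ) 1), s t = e.symm ⟨t, h⟩ := fun t h => dif_pos h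
  have ψ_eq : ∀ y (h : y ∈ C), ψ y = e ⟨y, h⟩ := fun y h => dif_pos h
  have sc : ContinuousOn s (Ioo 0 1) := by
    rw [continuousOn_iff_continuous_domRestrict]
    exact (continuous_subtype_val.comp e.symm.continuous).congr fun t => (s_eq t t.2).symm
  have ψc : ContinuousOn ψ C := by
    rw [continuousOn_iff_continuous_domRestrict]
    exact (continuous_subtype_val.comp e.continuous).congr fun y => (ψ_eq y y.2).symm
  have hsC : ∀ t ∈ Ioo (0 : ℝ) 1, s t ∈ C ∧ ψ (s t) = t := fun t ht => by
    rw [s_eq t ht]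
    exact ⟨Subtype.coe_prop _, by rw [ψ_eq _ (Subtype.coe_prop _)]; simp⟩
  have hψC : ∀ y ∈ C, ψ y ∈ Ioo (0 : ℝ) 1 := fun y hy => by
    rw [ψ_eq y hy]
    exact Subtype.coe_prop _
  have hψs : ∀ y ∈ C, s (ψ y) = y := fun y hy => by
    rw [s_eq _ (hψC y hy)]
    simp [ψ_eq y hy]
  have hrefl : ∀ {t : ℝ}, t ∈ Ioo (0 : ℝ) 1 → 1 - t ∈ Ioo (0 : ℝ) 1 := fun h =>
    ⟨by linarith [h.2], by linarith [h.1]⟩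
  obtain ⟨a, ha, hsa⟩ := exists_tendsto_end_of_arc hV hCV sc ψc hsC fun y hy => (hψC y hy).1
  obtain ⟨b, hb, hsb⟩ := exists_tendsto_end_of_arc hV hCV (s := fun t => s (1 - t))
    (ψ := fun y => 1 - ψ y)
    (sc.comp (by fun_prop) fun t ht => hrefl ht) (continuousOn_const.sub ψc)
    (fun t ht => ⟨(hsC _ (hrefl ht)).1, by rw [(hsC _ (hrefl ht)).2]; ring⟩)
    (fun y hy => by linarith [(hψC y hy).2])
  have hsb' : Tendsto s (𝓝[<] 1) (𝓝 b) := by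
    have : Tendsto (fun t : ℝ => 1 - t) (𝓝[<] 1) (𝓝[>] 0) := by
      refine tendsto_nhdsWithin_iff.2 ⟨?_, ?_⟩
      · exact (Continuous.tendsto' (by fun_prop) _ _ (by norm_num)).mono_left nhdsWithin_le_nhds
      · filter_upwards [self_mem_nhdsWithin] with t ht
        exact sub_pos.2 (mem_Iio.1 ht)
    simpa [Function.comp_def] using hsb.comp this
  set g := extendFrom (Ioo (0 : ℝ) 1) s
  have gc : ContinuousOn g (Icc 0 1) := continuousOn_Icc_extendFrom_Ioo sc hsa hsb'
  have gs : ∀ t ∈ Ioo (0 : ℝ) 1, g t = s t := fun t ht =>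
    extendFrom_extends sc t ht
  refine ⟨a, ha, b, hb, ⟨⟨fun t => g t, ?_⟩, ?_, ?_⟩, ?_, ?_⟩
  · exact gc.comp_continuous continuous_subtype_val fun t => t.2
  · exact eq_lim_at_left_extendFrom_Ioo zero_lt_one hsa
  · exact eq_lim_at_right_extendFrom_Ioo zero_lt_one hsb'
  · intro t ht u hu htu
    have ht' : (t : ℝ) ∈ Ioo (0 : ℝ) 1 := ⟨ht.1, ht.2⟩
    have hu' : (u : ℝ) ∈ Ioo (0 : ℝ) 1 := ⟨hu.1, hu.2⟩
    have htu : g t = g u := htu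
    rw [gs _ ht', gs _ hu'] at htu
    ext
    rw [← (hsC _ ht').2, htu, (hsC _ hu').2]
  · ext y
    constructor
    · rintro ⟨t, ht, rfl⟩
      have ht' : (t : ℝ) ∈ Ioo (0 : ℝ) 1 := ⟨ht.1, ht.2⟩
      change g t ∈ C
      rw [gs _ ht']
      exact (hsC _ ht').1
    · intro hy
      have h := hψC y hy
      exact ⟨⟨ψ y, h.1.le, h.2.le⟩, ⟨h.1, h.2⟩, (gs _ h).trans (hψs y hy)⟩

theorem exists_isEdge {G : Type*} [MetricSpace G] [CompactSpace G] {V E : Set G} (hV : V.Finite)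
    (hE : IsCompOf E Vᶜ) (harc : IsOpenArc E) (hcirc : ∀ C : Set G, ¬IsCircle C) :
    ∃ a b, IsEdge V E a b := by
  obtain ⟨a, ha, b, hb, γ, hinj, himg⟩ := exists_path_of_isOpenArc hV harc hE.closure_subset
  have hnot : ∀ t ∈ Ioo (0 : unitInterval) 1, γ t ∉ V := fun t ht =>
    hE.subset (himg ▸ mem_image_of_mem γ ht)
  have trich : ∀ t : unitInterval, t = 0 ∨ t = 1 ∨ t ∈ Ioo (0 : unitInterval) 1 := fun t => by
    rcases eq_or_ne t 0 with h | h
    · exact Or.inl h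
    rcases eq_or_ne t 1 with h' | h'
    · exact Or.inr (Or.inl h')
    · exact Or.inr (Or.inr ⟨unitInterval.pos_iff_ne_zero.2 h, unitInterval.lt_one_iff_ne_one.2 h'⟩)
  have loop : ∀ s t, γ s = γ t → s = t ∨ (s = 0 ∧ t = 1) ∨ (s = 1 ∧ t = 0) := by
    intro s t hst
    rcases trich s with rfl | rfl | hs <;> rcases trich t with rfl | rfl | ht
    any_goals simp
    · exact absurd (by rw [← hst, γ.source]; exact ha) (hnot t ht)
    · exact absurd (by rw [← hst, γ.target]; exact hb) (hnot t ht)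
    · exact absurd (by rw [hst, γ.source]; exact ha) (hnot s hs)
    · exact absurd (by rw [hst, γ.target]; exact hb) (hnot s hs)
    · exact Or.inl (hinj hs ht hst)
  have hab : a ≠ b := by
    rintro rfl
    exact hcirc _ (isCircle_range_of_simple_loop γ loop)
  have hγ : Function.Injective γ := by
    intro s t hst
    rcases loop s t hst with h | ⟨rfl, rfl⟩ | ⟨rfl, rfl⟩
    · exact h
    · exact absurd (by simpa using hst) hab
    · exact absurd (by simpa using hst.symm) hab
  have hcl : Set.range γ ⊆ closure E := by
    rw [← himg]
    rintro _ ⟨t, rfl⟩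
    refine image_closure_subset_closure_image γ.continuous ⟨t, ?_, rfl⟩
    rw [closure_Ioo zero_ne_one]
    exact ⟨t.2.1, t.2.2⟩
  refine ⟨a, b, hE, ha, hb, hab, hcl ⟨0, γ.source⟩, hcl ⟨1, γ.target⟩, γ, hγ, ?_⟩
  ext y
  constructor
  · rintro ⟨t, rfl⟩
    rcases trich t with rfl | rfl | ht
    · simp
    · simp
    · exact Or.inl (himg ▸ mem_image_of_mem γ ht)
  · rintro (hy | rfl | rfl)
    · obtain ⟨t, -, rfl⟩ := himg.symm ▸ hy
      exact ⟨t, rfl⟩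
    · exact ⟨0, γ.source⟩
    · exact ⟨1, γ.target⟩

theorem IsEdge.eq_of_ends {G : Type*} [TopologicalSpace G] [T2Space G] {V E E' : Set G} {a b : G}
    (h : IsEdge V E a b) (h' : IsEdge V E' a b) (hcirc : ∀ C : Set G, ¬IsCircle C) : E = E' := by
  by_contra hne
  refine hcirc _ (h.isArcBetween.isCircle_union h'.isArcBetween ?_)
  rintro y ⟨hy | hy, hy' | hy'⟩
  · exact absurd (h.isCompOf.eq_of_mem h'.isCompOf hy hy') hne
  all_goals assumption

theorem finite_components_of_no_circle {G : Type*} [TopologicalSpace G] [T2Space G] {V : Set G}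
    (hV : V.Finite) (hedge : ∀ E, IsCompOf E Vᶜ → ∃ a b, IsEdge V E a b)
    (hcirc : ∀ C : Set G, ¬IsCircle C) : {E | IsCompOf E Vᶜ}.Finite := by
  rcases isEmpty_or_nonempty G with hG | hG
  · exact Set.toFinite _
  choose! l r hlr using hedge
  refine Set.Finite.of_finite_image ((hV.prod hV).subset (s := V ×ˢ V)
    (t := (fun E => (l E, r E)) '' {E | IsCompOf E Vᶜ}) ?_) ?_
  · rintro _ ⟨E, hE, rfl⟩
    exact ⟨(hlr E hE).left_mem, (hlr E hE).right_mem⟩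
  · intro E hE E' hE' h
    simp only [Prod.mk.injEq] at h
    have h' := hlr E' hE'
    rw [← h.1, ← h.2] at h'
    exact (hlr E hE).eq_of_ends h' hcirc

/-- The abstract graph on the vertex set whose edges are the topological edges other than `C`. -/
def edgeGraph {G : Type*} [TopologicalSpace G] (V C : Set G) : SimpleGraph G where
  Adj a b := ∃ E ≠ C, IsEdge V E a b
  symm := ⟨fun _ _ ⟨E, hE, h⟩ => ⟨E, hE, h.symm⟩⟩
  loopless := ⟨fun _ ⟨_, _, h⟩ => h.ne rfl⟩

/-- A path in the abstract graph yields an arc that avoids `C` and is a union of closed edges. -/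
theorem exists_arc_of_isPath {G : Type*} [TopologicalSpace G] [T2Space G] {V C : Set G}
    (hC : IsCompOf C Vᶜ) {a b : G} (p : (edgeGraph V C).Walk a b) (hp : p.IsPath) :
    a = b ∨ ∃ K, IsArcBetween K a b ∧ (∀ y ∈ K, y ∈ V → y ∈ p.support) ∧
      (∀ y ∈ K, y ∉ V → connectedComponentIn Vᶜ y ⊆ K) ∧ Disjoint K C := by
  induction p with
  | nil => exact Or.inl rfl
  | @cons a c b hadj p ih =>
    right
    rw [SimpleGraph.Walk.cons_isPath_iff] at hp
    obtain ⟨E, hEC, hE⟩ := hadj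
    have hEV : ∀ y ∈ E, y ∉ V := fun y hy => hE.isCompOf.subset hy
    have hE_supp : ∀ y ∈ E ∪ {a, c}, y ∈ V → y = a ∨ y = c := by
      rintro y (hy | hy) hyV
      exacts [absurd hyV (hEV y hy), hy]
    have hEsupp' : ∀ y ∈ E ∪ {a, c}, y ∈ V → y ∈ a :: p.support := by
      intro y hy hyV
      rcases hE_supp y hy hyV with rfl | rfl
      exacts [List.mem_cons_self, List.mem_cons_of_mem _ p.start_mem_support]
    have hE_sat : ∀ y ∈ E ∪ {a, c}, y ∉ V → connectedComponentIn Vᶜ y ⊆ E ∪ {a, c} := by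
      rintro y (hy | rfl | rfl) hyV
      · rw [hE.isCompOf.connectedComponentIn_eq hy]
        exact subset_union_left
      · exact absurd hE.left_mem hyV
      · exact absurd hE.right_mem hyV
    have hE_disj : Disjoint (E ∪ {a, c}) C := by
      rw [disjoint_left]
      rintro y (hy | rfl | rfl) hyC
      · exact hEC (hE.isCompOf.eq_of_mem hC hy hyC)
      · exact hC.subset hyC hE.left_mem
      · exact hC.subset hyC hE.right_mem
    rcases ih hp.1 with rfl | ⟨K, hK, hKsupp, hKsat, hKdisj⟩
    · refine ⟨_, hE.isArcBetween, fun y hy hyV => ?_, hE_sat, hE_disj⟩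
      exact hEsupp' y hy hyV
    · have haK : a ∉ K := fun h => hp.2 (hKsupp a h hE.left_mem)
      have hEK : (E ∪ {a, c}) ∩ K ⊆ {c} := by
        rintro y ⟨hy | rfl | rfl, hyK⟩
        · have hsub := hKsat y hyK (hEV y hy)
          rw [hE.isCompOf.connectedComponentIn_eq hy] at hsub
          exact absurd (hK.isClosed.closure_subset_iff.2 hsub hE.left_mem_closure) haK
        · exact absurd hyK haK
        · rfl
      refine ⟨_, hE.isArcBetween.trans hK hEK ?_, ?_, ?_, hE_disj.union_left hKdisj⟩
      · rintro rfl
        exact haK hK.right_mem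
      · rintro y (hy | hy) hyV
        · exact hEsupp' y hy hyV
        · exact List.mem_cons_of_mem _ (hKsupp y hy hyV)
      · rintro y (hy | hy) hyV
        · exact (hE_sat y hy hyV).trans subset_union_left
        · exact (hKsat y hy hyV).trans subset_union_right

theorem IsEdge.not_reachable {G : Type*} [TopologicalSpace G] [T2Space G] {V C : Set G} {a b : G}
    (h : IsEdge V C a b) (hcirc : ∀ C : Set G, ¬IsCircle C) :
    ¬(edgeGraph V C).Reachable a b := by
  intro hr
  obtain ⟨p, hp⟩ := hr.exists_isPath
  rcases exists_arc_of_isPath h.isCompOf p hp with hab | ⟨K, hK, -, -, hKC⟩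
  · exact h.ne hab
  · refine hcirc _ (h.isArcBetween.isCircle_union hK ?_)
    rintro y ⟨hy | hy, hyK⟩
    · exact absurd hy (disjoint_left.1 hKC hyK)
    · exact hy

/-- Removing an open edge from a tree separates its endpoints. -/
theorem IsEdge.exists_separation {G : Type*} [TopologicalSpace G] [T2Space G] {V C : Set G}
    (hV : V.Finite) (hedge : ∀ E, IsCompOf E Vᶜ → ∃ a b, IsEdge V E a b)
    (hcirc : ∀ C : Set G, ¬IsCircle C) {a b : G} (h : IsEdge V C a b) :
    ∃ A B : Set G, IsClosed A ∧ IsClosed B ∧ Disjoint A B ∧ A ∪ B = Cᶜ ∧ a ∈ A ∧ b ∈ B := by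
  have hfin := finite_components_of_no_circle hV hedge hcirc
  have : Nonempty G := ⟨a⟩
  choose! l r hlr using hedge
  set R : Set G := {v | (edgeGraph V C).Reachable a v}
  set piece : Set G → Set G := fun S =>
    (V ∩ S) ∪ ⋃ E ∈ {E | IsCompOf E Vᶜ ∧ E ≠ C ∧ l E ∈ S}, E ∪ {l E, r E} with hpiece
  have hclosed : ∀ S, IsClosed (piece S) := fun S => by
    refine (hV.subset inter_subset_left).isClosed.union
      ((hfin.subset fun E hE => hE.1).isClosed_biUnion fun E hE => ?_)
    exact (hlr E hE.1).isArcBetween.isClosed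
  have hRr : ∀ E, IsCompOf E Vᶜ → E ≠ C → (r E ∈ R ↔ l E ∈ R) := fun E hE hEC => by
    have hadj : (edgeGraph V C).Adj (l E) (r E) := ⟨E, hEC, hlr E hE⟩
    exact ⟨fun hr => hr.trans hadj.symm.reachable, fun hl => hl.trans hadj.reachable⟩
  have mem_vertex : ∀ S, S = R ∨ S = Rᶜ → ∀ y ∈ piece S, y ∈ V → y ∈ S := by
    rintro S hS y (hy | hy) hyV
    · exact hy.2
    · obtain ⟨E, ⟨hE, hEC, hl⟩, hy⟩ := mem_iUnion₂.1 hy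
      rcases hy with hy | rfl | rfl
      · exact absurd hyV (hE.subset hy)
      · exact hl
      · rcases hS with rfl | rfl
        · exact (hRr E hE hEC).2 hl
        · exact fun h => hl ((hRr E hE hEC).1 h)
  have mem_edge : ∀ S, ∀ y ∈ piece S, y ∉ V →
      ∃ E, IsCompOf E Vᶜ ∧ E ≠ C ∧ l E ∈ S ∧ y ∈ E := by
    rintro S y (hy | hy) hyV
    · exact absurd hy.1 hyV
    · obtain ⟨E, ⟨hE, hEC, hl⟩, hy⟩ := mem_iUnion₂.1 hy
      rcases hy with hy | rfl | rfl
      · exact ⟨E, hE, hEC, hl, hy⟩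
      · exact absurd (hlr E hE).left_mem hyV
      · exact absurd (hlr E hE).right_mem hyV
  have not_mem_C : ∀ S, ∀ y ∈ piece S, y ∉ C := fun S y hy hyC => by
    obtain ⟨E, hE, hEC, -, hyE⟩ := mem_edge S y hy (h.isCompOf.subset hyC)
    exact hEC (hE.eq_of_mem h.isCompOf hyE hyC)
  refine ⟨piece R, piece Rᶜ, hclosed _, hclosed _, ?_, ?_, ?_, ?_⟩
  · rw [disjoint_left]
    intro y hy hy'
    by_cases hyV : y ∈ V
    · exact mem_vertex _ (Or.inr rfl) y hy' hyV (mem_vertex _ (Or.inl rfl) y hy hyV)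
    · obtain ⟨E, hE, -, hl, hyE⟩ := mem_edge _ y hy hyV
      obtain ⟨E', hE', -, hl', hyE'⟩ := mem_edge _ y hy' hyV
      exact hl' (hE.eq_of_mem hE' hyE hyE' ▸ hl)
  · refine Subset.antisymm (union_subset (not_mem_C R) (not_mem_C Rᶜ)) fun y hyC => ?_
    by_cases hyV : y ∈ V
    · by_cases hyR : y ∈ R
      · exact Or.inl (Or.inl ⟨hyV, hyR⟩)
      · exact Or.inr (Or.inl ⟨hyV, hyR⟩)
    · set E := connectedComponentIn Vᶜ y
      have hE : IsCompOf E Vᶜ := ⟨y, hyV, rfl⟩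
      have hyE : y ∈ E := mem_connectedComponentIn hyV
      have hEC : E ≠ C := fun h => hyC (h ▸ hyE)
      by_cases hl : l E ∈ R
      · exact Or.inl (Or.inr (mem_iUnion₂.2 ⟨E, ⟨hE, hEC, hl⟩, Or.inl hyE⟩))
      · exact Or.inr (Or.inr (mem_iUnion₂.2 ⟨E, ⟨hE, hEC, hl⟩, Or.inl hyE⟩))
  · exact Or.inl ⟨h.left_mem, SimpleGraph.Reachable.refl a⟩
  · exact Or.inl ⟨h.right_mem, h.not_reachable hcirc⟩

/-- Every open edge of a tree has a coordinate that extends continuously to the whole tree. -/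
theorem IsEdge.exists_continuous_parameter {G : Type*} [TopologicalSpace G] [T2Space G]
    {V C : Set G} (hV : V.Finite) (hedge : ∀ E, IsCompOf E Vᶜ → ∃ a b, IsEdge V E a b)
    (hcirc : ∀ C : Set G, ¬IsCircle C) {a b : G} (h : IsEdge V C a b) :
    ∃ (φ : G → ℝ) (s : ℝ → G), Continuous φ ∧ Continuous s ∧
      (∀ y, φ y ∈ Ioo (0 : ℝ) 1 → s (φ y) = y) ∧ ∀ y ∈ C, φ y ∈ Ioo (0 : ℝ) 1 := by
  obtain ⟨A, B, hA, hB, hAB, hcover, ha, hb⟩ := h.exists_separation hV hedge hcirc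
  obtain ⟨γ, hγ, hrange⟩ := h.isArcBetween
  have hout : ∀ y ∈ C, y ∉ A ∧ y ∉ B := fun y hy => by
    have : y ∉ A ∪ B := by
      rw [hcover]
      exact not_not.2 hy
    simpa using this
  have hends : ∀ t, γ t ∈ C ∨ t = 0 ∨ t = 1 := fun t => by
    have : γ t ∈ C ∪ {a, b} := hrange ▸ mem_range_self t
    rcases this with h | h | h
    exacts [Or.inl h, Or.inr (Or.inl (hγ (h.trans γ.source.symm))),
      Or.inr (Or.inr (hγ (Eq.trans h γ.target.symm)))]
  have hγA : ∀ t, γ t ∈ A ↔ t = 0 := fun t => by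
    refine ⟨fun ht => ?_, fun ht => by rwa [ht, γ.source]⟩
    rcases hends t with h | h | rfl
    · exact absurd ht (hout _ h).1
    · exact h
    · exact absurd (γ.target ▸ ht) (disjoint_right.1 hAB hb)
  have hγB : ∀ t, γ t ∈ B ↔ t = 1 := fun t => by
    refine ⟨fun ht => ?_, fun ht => by rwa [ht, γ.target]⟩
    rcases hends t with h | rfl | h
    · exact absurd ht (hout _ h).2
    · exact absurd (γ.source ▸ ht) (disjoint_left.1 hAB ha)
    · exact h
  have huniv : A ∪ B ∪ Set.range γ = univ := by
    rw [hcover, hrange, eq_univ_iff_forall]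
    intro y
    by_cases hy : y ∈ C
    · exact Or.inr (Or.inl hy)
    · exact Or.inl hy
  obtain ⟨φ, hφ, hφs, hφC⟩ :=
    exists_continuous_parameter_of_separated hA hB hAB hγ hγA hγB huniv
  exact ⟨φ, γ.extend, hφ, γ.continuous_extend, hφs,
    fun y hy => hφC y (hout y hy).1 (hout y hy).2⟩

/-- for a tree map `f : T → T`, `cl(R(f)) = cl(P(f))`. -/
theorem tree_closure_recurrent_eq_closure_periodic {T : Type*} [MetricSpace T]
    (V : Set T) (hG : IsTopGraph V)
    (hTree : ∀ C : Set T, ¬IsCircle C)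
    (f : T → T) (hf : Continuous f) :
    closure (recurrentPts f) = closure (Function.periodicPts f) := by
  have := hG.compact
  have hedge : ∀ E, IsCompOf E Vᶜ → ∃ a b, IsEdge V E a b := fun E hE => by
    obtain ⟨x, hx, rfl⟩ := hE
    exact exists_isEdge hG.finite_vertexSet ⟨x, hx, rfl⟩ (hG.component_openArc x hx) hTree
  refine Subset.antisymm (closure_minimal ?_ isClosed_closure)
    (closure_mono (periodicPts_subset_recurrentPts f))
  refine recurrentPts_subset_closure_periodicPts hf hG.finite_vertexSet fun x hx hxV => ?_
  obtain ⟨a, b, hE⟩ := hedge _ ⟨x, hxV, rfl⟩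
  obtain ⟨φ, s, hφ, hs, hsφ, hφC⟩ :=
    hE.exists_continuous_parameter hG.finite_vertexSet hedge hTree
  exact mem_closure_periodicPts_of_free_arc hf hφ hs hsφ hx
    (hφC x (mem_connectedComponentIn hxV))
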